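/- Let v = (v_p)_{p ∈ ℝᵐ} be a Schwartz family of tempered distributions on ℝⁿ. Then for every tempered distribution a ∈ 𝓢'(ℝᵐ), the functional on 𝓢(ℝⁿ, ℂ) given by φ ↦ a(v(φ)) (i.e. the composition a ∘ v̂) is a tempered distribution, that is, it is linear and continuous on 𝓢(ℝⁿ, ℂ). -/

import Mathlib

open SchwartzMap

namespace SchwartzMap

open Filter Topology
open scoped ContDiff

section Complete

variable {E F : Type*} [NormedAddCommGroup E] [NormedSpace ℝ E]
  [NormedAddCommGroup F] [NormedSpace ℝ F]

theorem pow_mul_norm_iteratedFDeriv_sub_le_seminorm (k l : ℕ) (f g : 𝓢(E, F)) (x : E) :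
    ‖x‖ ^ k * ‖iteratedFDeriv ℝ l f x - iteratedFDeriv ℝ l g x‖ ≤
      SchwartzMap.seminorm ℝ k l (f - g) := by
  have h := le_seminorm ℝ k l (f - g) x
  rwa [FunLike.coe_sub, iteratedFDeriv_sub_apply (f.smooth l).contDiffAt
    (g.smooth l).contDiffAt] at h

theorem _root_.CauchySeq.exists_seminorm_sub_lt {u : ℕ → 𝓢(E, F)} (hu : CauchySeq u) (k l : ℕ)
    {ε : ℝ} (hε : 0 < ε) :
    ∃ N, ∀ m ≥ N, ∀ n ≥ N, SchwartzMap.seminorm ℝ k l (u m - u n) < ε := by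
  have hcont : Continuous (SchwartzMap.seminorm ℝ k l : Seminorm ℝ 𝓢(E, F)) :=
    (schwartz_withSeminorms ℝ E F).continuous_seminorm (k, l)
  have hnhds : {f : 𝓢(E, F) | SchwartzMap.seminorm ℝ k l f < ε} ∈ 𝓝 0 :=
    (isOpen_lt hcont continuous_const).mem_nhds (by simpa using hε)
  have hunif : {q : 𝓢(E, F) × 𝓢(E, F) | SchwartzMap.seminorm ℝ k l (q.2 - q.1) < ε} ∈
      uniformity 𝓢(E, F) := by
    rw [uniformity_eq_comap_nhds_zero]
    exact preimage_mem_comap hnhds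
  obtain ⟨N, hN⟩ := cauchySeq_iff.1 hu _ hunif
  exact ⟨N, fun m hm n hn => hN n hn m hm⟩

variable [CompleteSpace F]

theorem _root_.CauchySeq.exists_tendsto_schwartzMap {u : ℕ → 𝓢(E, F)} (hu : CauchySeq u) :
    ∃ f, Tendsto u atTop (𝓝 f) := by
  have hcauchy (x : E) (l : ℕ) : CauchySeq fun n => iteratedFDeriv ℝ l (u n) x := by
    refine Metric.cauchySeq_iff.2 fun ε hε => ?_
    obtain ⟨N, hN⟩ := hu.exists_seminorm_sub_lt 0 l hε
    refine ⟨N, fun m hm n hn => ?_⟩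
    rw [dist_eq_norm]
    simpa using (pow_mul_norm_iteratedFDeriv_sub_le_seminorm 0 l (u m) (u n) x).trans_lt
      (hN m hm n hn)
  choose g hg using fun x l => cauchySeq_tendsto_of_complete (hcauchy x l)
  have hbound (k l : ℕ) {ε : ℝ} (hε : 0 < ε) :
      ∃ N, ∀ n ≥ N, ∀ x, ‖x‖ ^ k * ‖iteratedFDeriv ℝ l (u n) x - g x l‖ ≤ ε := by
    obtain ⟨N, hN⟩ := hu.exists_seminorm_sub_lt k l hε
    refine ⟨N, fun n hn x => ?_⟩
    refine le_of_tendsto (((hg x l).const_sub _).norm.const_mul _) ?_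
    filter_upwards [eventually_ge_atTop N] with m hm
    exact (pow_mul_norm_iteratedFDeriv_sub_le_seminorm k l (u n) (u m) x).trans (hN n hn m hm).le
  have hunif (l : ℕ) :
      TendstoUniformly (fun n x => iteratedFDeriv ℝ l (u n) x) (fun x => g x l) atTop := by
    refine Metric.tendstoUniformly_iff.2 fun ε hε => ?_
    obtain ⟨N, hN⟩ := hbound 0 l (half_pos hε)
    filter_upwards [eventually_ge_atTop N] with n hn x
    rw [dist_comm, dist_eq_norm]
    have := hN n hn x
    rw [pow_zero, one_mul] at this
    linarith
  have htaylor : HasFTaylorSeriesUpTo ∞ (fun x => (g x 0).curry0) g := by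
    refine (hasFTaylorSeriesUpTo_top_iff' le_rfl).2 ⟨fun x => rfl, fun l x => ?_⟩
    let L := continuousMultilinearCurryLeftEquiv ℝ (fun _ : Fin (l + 1) => E) F
    refine hasFDerivAt_of_tendstoUniformly (l := atTop)
      (f := fun n y => iteratedFDeriv ℝ l (u n) y)
      (f' := fun n y => L (iteratedFDeriv ℝ (l + 1) (u n) y)) (g' := fun y => L (g y (l + 1)))
      (L.isometry.uniformContinuous.comp_tendstoUniformly (hunif (l + 1)))
      (fun n y => ?_) (fun y => hg y l) x
    have hd : DifferentiableAt ℝ (iteratedFDeriv ℝ l (u n)) y :=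
      ((u n).smooth (l + 1)).differentiable_iteratedFDeriv (by exact_mod_cast l.lt_succ_self) y
    simpa [L, iteratedFDeriv_succ_eq_comp_left] using hd.hasFDerivAt
  have hderiv (l : ℕ) (x : E) : iteratedFDeriv ℝ l (fun x => (g x 0).curry0) x = g x l :=
    (htaylor.eq_iteratedFDeriv (by exact_mod_cast le_top) x).symm
  let f : 𝓢(E, F) :=
    { toFun := fun x => (g x 0).curry0
      smooth' := HasFTaylorSeriesUpTo.contDiff (n := ⊤) htaylor
      decay' := fun k l => by
        obtain ⟨N, hN⟩ := hbound k l one_pos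
        refine ⟨SchwartzMap.seminorm ℝ k l (u N) + 1, fun x => ?_⟩
        rw [hderiv]
        calc ‖x‖ ^ k * ‖g x l‖
            ≤ ‖x‖ ^ k * (‖iteratedFDeriv ℝ l (u N) x‖ + ‖iteratedFDeriv ℝ l (u N) x - g x l‖) := by
              gcongr
              exact norm_le_norm_add_norm_sub _ _
          _ ≤ SchwartzMap.seminorm ℝ k l (u N) + 1 := by
              rw [mul_add]
              exact add_le_add (le_seminorm ℝ k l (u N) x) (hN N le_rfl x) }
  refine ⟨f, ((schwartz_withSeminorms ℝ E F).tendsto_nhds_atTop u f).2 ?_⟩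
  rintro ⟨k, l⟩ ε hε
  obtain ⟨N, hN⟩ := hbound k l (half_pos hε)
  refine ⟨N, fun n hn => ?_⟩
  refine (seminorm_le_bound ℝ k l (u n - f) (half_pos hε).le fun x => ?_).trans_lt
    (half_lt_self hε)
  rw [FunLike.coe_sub, iteratedFDeriv_sub_apply ((u n).smooth l).contDiffAt
    (f.smooth l).contDiffAt]
  exact (hderiv l x).symm ▸ hN n hn x

instance instIsCountablyGeneratedUniformity : (uniformity 𝓢(E, F)).IsCountablyGenerated :=
  IsUniformAddGroup.uniformity_countably_generated

instance instCompleteSpace : CompleteSpace 𝓢(E, F) :=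
  UniformSpace.complete_of_cauchySeq_tendsto fun _ hu => hu.exists_tendsto_schwartzMap

end Complete

section PointwiseContinuous

variable {X D G : Type*} [AddCommGroup X] [Module ℝ X] [UniformSpace X] [IsUniformAddGroup X]
  [ContinuousSMul ℝ X] [BarrelledSpace ℝ X]
  [NormedAddCommGroup D] [NormedSpace ℝ D] [FiniteDimensional ℝ D]
  [NormedAddCommGroup G] [NormedSpace ℝ G]

theorem _root_.LinearMap.continuous_fderiv_apply {T : X →ₗ[ℝ] D → G}
    (hT : ∀ y, Continuous fun φ => T φ y) (hd : ∀ φ, Differentiable ℝ (T φ)) (y : D) :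
    Continuous fun φ => fderiv ℝ (T φ) y := by
  refine continuous_clm_apply.2 fun h => ?_
  let ev (z : D) : X →L[ℝ] G := ⟨(LinearMap.proj z).comp T, hT z⟩
  let quotient (n : ℕ) : X →L[ℝ] G :=
    ((n : ℝ) + 1) • (ev (y + ((n : ℝ) + 1)⁻¹ • h) - ev y)
  have hlim : Tendsto (fun n φ => quotient n φ) atTop (𝓝 fun φ => fderiv ℝ (T φ) y h) := by
    refine tendsto_pi_nhds.2 fun φ => ?_
    have hc : Tendsto (fun n : ℕ => ‖(n : ℝ) + 1‖) atTop atTop :=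
      tendsto_norm_atTop_atTop.comp
        (tendsto_atTop_add_const_right _ _ tendsto_natCast_atTop_atTop)
    exact (hd φ y).hasFDerivAt.lim h hc
  exact (continuousLinearMapOfTendsto quotient hlim).continuous

theorem _root_.LinearMap.continuous_iteratedFDeriv_apply {T : X →ₗ[ℝ] 𝓢(D, G)}
    (hT : ∀ y, Continuous fun φ => T φ y) (l : ℕ) (y : D) :
    Continuous fun φ => iteratedFDeriv ℝ l (T φ) y := by
  induction l generalizing y with
  | zero =>
    simpa only [iteratedFDeriv_zero_eq_comp] using!
      (continuousMultilinearCurryFin0 ℝ D G).symm.continuous.comp (hT y)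
  | succ l ih =>
    let S : X →ₗ[ℝ] D → D [×l]→L[ℝ] G :=
      { toFun := fun φ => iteratedFDeriv ℝ l (T φ)
        map_add' := fun φ ψ => by
          ext1 z
          rw [map_add, FunLike.coe_add, iteratedFDeriv_add_apply ((T φ).smooth l).contDiffAt
            ((T ψ).smooth l).contDiffAt, Pi.add_apply]
        map_smul' := fun c φ => by
          ext1 z
          rw [map_smul, FunLike.coe_smul, iteratedFDeriv_const_smul_apply
            ((T φ).smooth l).contDiffAt]
          rfl }
    have hS : Continuous fun φ => fderiv ℝ (S φ) y :=
      LinearMap.continuous_fderiv_apply ih (fun φ =>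
        ((T φ).smooth (l + 1)).differentiable_iteratedFDeriv (by exact_mod_cast l.lt_succ_self)) y
    exact (continuousMultilinearCurryLeftEquiv ℝ (fun _ : Fin (l + 1) => D) G).symm.continuous.comp
      hS

/-- A linear map from a barrelled space into a Schwartz space is continuous as soon as it is
pointwise continuous. -/
theorem _root_.LinearMap.continuous_of_continuous_eval {T : X →ₗ[ℝ] 𝓢(D, G)}
    (hT : ∀ y, Continuous fun φ => T φ y) : Continuous T := by
  refine (schwartz_withSeminorms ℝ D G).continuous_of_continuous_comp T ?_
  rintro ⟨k, l⟩
  refine Seminorm.continuous_of_lowerSemicontinuous _ fun φ r hr => ?_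
  rcases lt_or_ge r 0 with hr0 | hr0
  · exact Eventually.of_forall fun ψ => hr0.trans_le (apply_nonneg _ ψ)
  obtain ⟨y, hy⟩ : ∃ y, r < ‖y‖ ^ k * ‖iteratedFDeriv ℝ l (T φ) y‖ := by
    by_contra! h
    exact (seminorm_le_bound ℝ k l (T φ) hr0 h).not_gt hr
  have hcont : Continuous fun ψ => ‖y‖ ^ k * ‖iteratedFDeriv ℝ l (T ψ) y‖ :=
    continuous_const.mul (LinearMap.continuous_iteratedFDeriv_apply hT l y).norm
  filter_upwards [hcont.continuousAt.eventually_const_lt hy] with ψ hψ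
  exact hψ.trans_le (le_seminorm ℝ k l (T ψ) y)

end PointwiseContinuous

end SchwartzMap

/-- Let `v = (v_p)_{p ∈ ℝᵐ}` be a Schwartz family of tempered
distributions on `ℝⁿ`, i.e. there is a map `vhat : 𝓢(ℝⁿ) → 𝓢(ℝᵐ)` with
`vhat φ p = v p φ` for all `φ`, `p`.  Then for every tempered distribution
`a ∈ 𝓢'(ℝᵐ)` the functional `φ ↦ a (vhat φ)` is linear and continuous, i.e. a
tempered distribution. -/
theorem statement0 (n m : ℕ)
    (v : EuclideanSpace ℝ (Fin m) →
      (SchwartzMap (EuclideanSpace ℝ (Fin n)) ℂ →L[ℂ] ℂ))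
    (vhat : SchwartzMap (EuclideanSpace ℝ (Fin n)) ℂ →
      SchwartzMap (EuclideanSpace ℝ (Fin m)) ℂ)
    (hv : ∀ (φ : SchwartzMap (EuclideanSpace ℝ (Fin n)) ℂ)
      (p : EuclideanSpace ℝ (Fin m)), vhat φ p = v p φ)
    (a : SchwartzMap (EuclideanSpace ℝ (Fin m)) ℂ →L[ℂ] ℂ) :
    IsLinearMap ℂ (fun φ : SchwartzMap (EuclideanSpace ℝ (Fin n)) ℂ => a (vhat φ)) ∧
      Continuous (fun φ : SchwartzMap (EuclideanSpace ℝ (Fin n)) ℂ => a (vhat φ)) := by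
  let T : SchwartzMap (EuclideanSpace ℝ (Fin n)) ℂ →ₗ[ℂ]
      SchwartzMap (EuclideanSpace ℝ (Fin m)) ℂ :=
    { toFun := vhat
      map_add' := fun φ ψ => by ext p; simp [hv]
      map_smul' := fun c φ => by ext p; simp [hv] }
  have hT : Continuous T :=
    LinearMap.continuous_of_continuous_eval (T := T.restrictScalars ℝ) fun p =>
      (v p).continuous.congr fun φ => (hv φ p).symm
  exact ⟨(a.toLinearMap ∘ₗ T).isLinear, a.continuous.comp hT⟩
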